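/- Let (X, ρ, μ) be a quasimetric measure space and let 1 < p < q < ∞, 0 < α < 1, and set s = pq(1-α)/(pq + p - q). Suppose μ(B(a,r)) ≤ C r^s for all a ∈ X, r > 0. Assume 0 < λ₁ < p/q and sλ₁/p = λ₂/q. Then the operator I_α is bounded from the Morrey space M^{p, λ₁ s}(X,μ) to M^{q, λ₂}(X,μ). -/

import Mathlib

open MeasureTheory ENNReal Set

variable {X : Type*} [MeasurableSpace X]

/-- Quasimetric ball `B(a,r) = {x : ρ(a,x) < r}`. -/
def qball (ρ : X → X → ℝ) (a : X) (r : ℝ) : Set X := {x | ρ a x < r}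

/-- Weighted Morrey norm `‖f‖_{M_β^{p,λ}(X,μ)}`. -/
noncomputable def wMorreyNorm (ρ : X → X → ℝ) (μ : Measure X) (p lam beta : ℝ)
    (f : X → ℝ≥0∞) : ℝ≥0∞ :=
  ⨆ (a : X) (r : ℝ) (_ : 0 < r),
    ((ENNReal.ofReal r) ^ (-lam) *
      ∫⁻ y in qball ρ a r, f y ^ p * ENNReal.ofReal (ρ a y ^ beta) ∂μ) ^ (1/p)

/-- The fractional integral operator `I_α`. -/
noncomputable def Iop (ρ : X → X → ℝ) (μ : Measure X) (α : ℝ) (f : X → ℝ≥0∞) (x : X) : ℝ≥0∞ :=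
  ∫⁻ y, f y * ENNReal.ofReal (ρ x y ^ (α - 1)) ∂μ

/-- A quasimetric, possibly vanishing off the diagonal, with constants `a₀` (symmetry) and
`a₁` (triangle inequality). -/
structure IsQuasimetric (ρ : X → X → ℝ) (a₀ a₁ : ℝ) : Prop where
  one_le_symm : 1 ≤ a₀
  one_le_tri : 1 ≤ a₁
  nonneg : ∀ x y, 0 ≤ ρ x y
  self : ∀ x, ρ x x = 0
  symm : ∀ x y, ρ x y ≤ a₀ * ρ y x
  tri : ∀ x y z, ρ x y ≤ a₁ * (ρ x z + ρ z y)

theorem sigmaFinite_of_qball {ρ : X → X → ℝ} {μ : Measure X}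
    (hfin : ∀ a r, μ (qball ρ a r) < ⊤) : SigmaFinite μ := by
  cases isEmpty_or_nonempty X
  · rw [Measure.eq_zero_of_isEmpty μ]
    infer_instance
  · obtain ⟨a⟩ := ‹Nonempty X›
    refine ⟨⟨⟨fun n : ℕ => qball ρ a n, fun _ => trivial, fun n => hfin a n, ?_⟩⟩⟩
    refine eq_univ_of_forall fun x => ?_
    obtain ⟨n, hn⟩ := exists_nat_gt (ρ a x)
    exact mem_iUnion.2 ⟨n, hn⟩

/-- The points around which `t`-balls have positive measure are covered by countably many enlarged
`t`-balls. -/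
theorem IsQuasimetric.exists_countable_cover {ρ : X → X → ℝ} {μ : Measure X} {a₀ a₁ : ℝ}
    (hρ : IsQuasimetric ρ a₀ a₁) (hmeas : ∀ a r, MeasurableSet (qball ρ a r))
    (hfin : ∀ a r, μ (qball ρ a r) < ⊤) {t : ℝ} (ht : 0 < t) :
    ∃ u : Set X, u.Countable ∧
      ∀ x, μ (qball ρ x t) ≠ 0 → ∃ z ∈ u, x ∈ qball ρ z (a₁ * (1 + a₀) * t) := by
  have := sigmaFinite_of_qball hfin
  obtain ⟨u, hus, hdisj, hcov⟩ := Vitali.exists_disjoint_subfamily_covering_enlargement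
    (fun x => qball ρ x t) {x | μ (qball ρ x t) ≠ 0} (fun _ => 1) 2 one_lt_two
    (fun _ _ => zero_le_one) 1 (fun _ _ => le_rfl)
    (fun x _ => ⟨x, by simpa [qball, hρ.self] using ht⟩)
  refine ⟨u, ?_, fun x hx => ?_⟩
  · have hc := Measure.countable_meas_pos_of_disjoint_iUnion (μ := μ)
      (As := fun z : u => qball ρ (z : X) t) (fun _ => hmeas _ _)
      (fun y z hyz => hdisj y.2 z.2 (Subtype.coe_injective.ne hyz))
    have hc' : (univ : Set u).Countable :=
      hc.mono fun z _ => pos_iff_ne_zero.2 (hus z.2)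
    exact countable_coe_iff.1 (countable_univ_iff.1 hc')
  · obtain ⟨z, hz, ⟨w, hw, hw'⟩, -⟩ := hcov x hx
    refine ⟨z, hz, ?_⟩
    simp only [qball, mem_ofPred_eq] at hw hw' ⊢
    have h1 := hρ.tri z x w
    have h2 := hρ.symm w x
    have ha := hρ.one_le_symm
    have h3 : a₀ * ρ x w < a₀ * t := by gcongr
    have h4 : a₁ * (ρ z w + ρ w x) < a₁ * (t + a₀ * t) :=
      mul_lt_mul_of_pos_left (by linarith) (by linarith [hρ.one_le_tri])
    linarith

/-- Ball averages `x ↦ ∫_{B(x,t)} g` need not be measurable, since `ρ` is not assumed jointly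
measurable. They nevertheless have measurable majorants of the same size, for which an upper Tonelli
estimate holds. -/
theorem IsQuasimetric.exists_measurable_majorant {ρ : X → X → ℝ} {μ : Measure X} {a₀ a₁ : ℝ}
    (hρ : IsQuasimetric ρ a₀ a₁) (hmeas : ∀ a r, MeasurableSet (qball ρ a r))
    (hfin : ∀ a r, μ (qball ρ a r) < ⊤) :
    ∃ K : ℝ, 1 ≤ K ∧ ∀ t : ℝ, 0 < t → ∀ g : X → ℝ≥0∞, Measurable g →
      ∃ G : X → ℝ≥0∞, Measurable G ∧ (∀ x, ∫⁻ y in qball ρ x t, g y ∂μ ≤ G x) ∧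
        (∀ x, G x ≤ ∫⁻ y in qball ρ x (K * t), g y ∂μ) ∧
        ∀ M : ℝ≥0∞, (∀ y, μ (qball ρ y (K * t)) ≤ M) → ∀ a r, t ≤ r →
          ∫⁻ x in qball ρ a r, G x ∂μ ≤ M * ∫⁻ y in qball ρ a (K * r), g y ∂μ := by
  have ha₀ := hρ.one_le_symm
  have ha₁ := hρ.one_le_tri
  obtain ⟨c₁, hc₁⟩ : ∃ c, c = a₁ * (1 + a₀) := ⟨_, rfl⟩
  have hc₁1 : 1 ≤ c₁ := by rw [hc₁]; nlinarith
  obtain ⟨c₂, hc₂⟩ : ∃ c, c = a₁ * (c₁ + 1) := ⟨_, rfl⟩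
  have hc₂1 : 1 ≤ c₂ := by rw [hc₂]; nlinarith
  obtain ⟨c₃, hc₃⟩ : ∃ c, c = a₁ * (a₀ * c₁ + a₀ * c₂) := ⟨_, rfl⟩
  have hc₃1 : 1 ≤ c₃ := by
    have : 1 ≤ a₀ * c₁ := one_le_mul_of_one_le_of_one_le ha₀ hc₁1
    have : 1 ≤ a₀ * c₂ := one_le_mul_of_one_le_of_one_le ha₀ hc₂1
    rw [hc₃]; nlinarith
  obtain ⟨K, hK⟩ : ∃ c, c = a₁ * (1 + c₃) := ⟨_, rfl⟩
  have hKc : c₃ ≤ K := by rw [hK]; nlinarith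
  refine ⟨K, hc₃1.trans hKc, fun t ht g hg => ?_⟩
  have quasi : ∀ {x y z : X} {b c e : ℝ}, ρ x z < b → ρ z y < c → a₁ * (b + c) ≤ e → ρ x y < e :=
    fun {x y z b c e} h h' he => by
      have := hρ.tri x y z
      have : a₁ * (ρ x z + ρ z y) < a₁ * (b + c) :=
        mul_lt_mul_of_pos_left (by linarith) (by linarith)
      linarith
  have flip : ∀ {x y : X} {b : ℝ}, ρ x y < b → ρ y x < a₀ * b := fun {x y b} h =>
    (hρ.symm y x).trans_lt (mul_lt_mul_of_pos_left h (by linarith))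
  obtain ⟨u, huc, hu⟩ := hρ.exists_countable_cover hmeas hfin ht
  rw [← hc₁] at hu
  rcases u.eq_empty_or_nonempty with rfl | hne
  · refine ⟨0, measurable_zero, fun x => ?_, fun x => by simp, fun M _ a r _ => by simp⟩
    have : μ (qball ρ x t) = 0 := by
      by_contra h
      simpa using hu x h
    simp [Measure.restrict_eq_zero.2 this]
  obtain ⟨z, rfl⟩ := huc.exists_eq_range hne
  obtain ⟨A, hA⟩ : ∃ A, A = disjointed fun n => qball ρ (z n) (c₁ * t) := ⟨_, rfl⟩
  have hAm : ∀ n, MeasurableSet (A n) := fun n => by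
    rw [hA]; exact MeasurableSet.disjointed (fun n => hmeas _ _) n
  have hAd : Pairwise (Function.onFun Disjoint A) := hA ▸ disjoint_disjointed _
  have hAs : ∀ {n x}, x ∈ A n → ρ (z n) x < c₁ * t := fun {n x} hx => by
    rw [hA] at hx; exact disjointed_subset _ n hx
  obtain ⟨B, hB⟩ : ∃ B, B = fun n => qball ρ (z n) (c₂ * t) := ⟨_, rfl⟩
  have hBm : ∀ n, MeasurableSet (B n) := fun n => hB ▸ hmeas _ _
  have hABlow : ∀ {n x}, x ∈ A n → qball ρ x t ⊆ B n := fun {n x} hx y hy => by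
    rw [hB]
    exact quasi (hAs hx) hy (by rw [hc₂]; linarith)
  have hAB : ∀ {n x y}, x ∈ A n → y ∈ B n → ρ x y < c₃ * t ∧ ρ y x < c₃ * t :=
    fun {n x y} hx hy => by
      rw [hB] at hy
      refine ⟨quasi (flip (hAs hx)) hy ?_, quasi (flip hy) (hAs hx) ?_⟩ <;> rw [hc₃]
      · have : c₂ ≤ a₀ * c₂ := le_mul_of_one_le_left (by linarith) ha₀
        have : a₁ * c₂ * t ≤ a₁ * (a₀ * c₂) * t := by gcongr
        linarith
      · have : c₁ ≤ a₀ * c₁ := le_mul_of_one_le_left (by linarith) ha₀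
        have : a₁ * c₁ * t ≤ a₁ * (a₀ * c₁) * t := by gcongr
        linarith
  refine ⟨fun x => ∑' n, (A n).indicator (fun _ => ∫⁻ y in B n, g y ∂μ) x,
    Measurable.tsum fun n => measurable_const.indicator (hAm n), fun x => ?_, fun x => ?_,
    fun M hM a r htr => ?_⟩
  · by_cases h : μ (qball ρ x t) = 0
    · simp [Measure.restrict_eq_zero.2 h]
    · obtain ⟨_, ⟨m, rfl⟩, hm⟩ := hu x h
      have : x ∈ ⋃ n, A n := by
        rw [hA, iUnion_disjointed]
        exact mem_iUnion.2 ⟨m, hm⟩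
      obtain ⟨n, hn⟩ := mem_iUnion.1 this
      refine le_trans ?_ (ENNReal.le_tsum n)
      rw [indicator_of_mem hn]
      exact lintegral_mono_set (hABlow hn)
  · by_cases h : ∃ n, x ∈ A n
    · obtain ⟨n, hn⟩ := h
      beta_reduce
      rw [tsum_eq_single n fun m hm => indicator_of_notMem
        (fun hx => disjoint_left.1 (hAd hm) hx hn) _, indicator_of_mem hn]
      refine lintegral_mono_set fun y hy => (hAB hn hy).1.trans_le ?_
      gcongr
    · push Not at h
      simp [h]
  · calc ∫⁻ x in qball ρ a r, ∑' n, (A n).indicator (fun _ => ∫⁻ y in B n, g y ∂μ) x ∂μ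
        = ∑' n, (∫⁻ y in B n, g y ∂μ) * μ (A n ∩ qball ρ a r) := by
          rw [lintegral_tsum fun n => (measurable_const.indicator (hAm n)).aemeasurable]
          refine tsum_congr fun n => ?_
          rw [lintegral_indicator_const (hAm n), Measure.restrict_apply (hAm n)]
      _ = ∫⁻ y, ∑' n, (B n).indicator (fun y => g y * μ (A n ∩ qball ρ a r)) y ∂μ := by
          rw [lintegral_tsum fun n => ((hg.mul_const _).indicator (hBm n)).aemeasurable]
          refine tsum_congr fun n => ?_
          rw [lintegral_indicator (hBm n), lintegral_mul_const _ hg]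
      _ ≤ ∫⁻ y, (qball ρ a (K * r)).indicator (fun y => M * g y) y ∂μ := by
          refine lintegral_mono fun y => ?_
          obtain ⟨D, hD⟩ : ∃ D : ℕ → Set X, D = fun n => {x | x ∈ A n ∩ qball ρ a r ∧ y ∈ B n} :=
            ⟨_, rfl⟩
          have hDA : ∀ n, D n ⊆ A n := fun n x hx => by
            rw [hD] at hx; exact hx.1.1
          have hDpos : ∀ n, y ∈ B n → D n = A n ∩ qball ρ a r := fun n hy => by
            ext; simp [hD, hy]
          have hDneg : ∀ n, y ∉ B n → D n = ∅ := fun n hy => by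
            ext; simp [hD, hy]
          have hsum : ∑' n, (B n).indicator (fun y => g y * μ (A n ∩ qball ρ a r)) y
              = g y * ∑' n, μ (D n) := by
            rw [← ENNReal.tsum_mul_left]
            refine tsum_congr fun n => ?_
            by_cases hy : y ∈ B n
            · simp [hDpos n hy, hy]
            · simp [hDneg n hy, hy]
          have hDm : ∀ n, MeasurableSet (D n) := fun n => by
            by_cases hy : y ∈ B n
            · simpa [hDpos n hy] using (hAm n).inter (hmeas a r)
            · simp [hDneg n hy]
          rw [hsum, ← measure_iUnion (fun m n hmn => (hAd hmn).mono (hDA m) (hDA n)) hDm]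
          by_cases hy : y ∈ qball ρ a (K * r)
          · rw [indicator_of_mem hy, mul_comm]
            gcongr
            refine (measure_mono (iUnion_subset fun n x hx => ?_)).trans (hM y)
            rw [hD] at hx
            exact (hAB hx.1.1 hx.2).2.trans_le (by gcongr)
          · have : ⋃ n, D n = ∅ := by
              refine iUnion_eq_empty.2 fun n => eq_empty_of_forall_notMem fun x hx => hy ?_
              rw [hD] at hx
              refine quasi hx.1.2 (hAB hx.1.1 hx.2).1 ?_
              have : a₁ * (c₃ * t) ≤ a₁ * (c₃ * r) := by gcongr
              rw [hK]
              linarith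
            simp [this]
      _ = M * ∫⁻ y in qball ρ a (K * r), g y ∂μ := by
          rw [lintegral_indicator (hmeas _ _), lintegral_const_mul _ hg]

theorem ENNReal.tsum_mul_rpow_le {ι : Type*} (u b : ι → ℝ≥0∞) {q : ℝ} (hq : 0 < q) :
    (∑' k, u k * b k) ^ q ≤ (∑' k, u k) ^ q * ∑' k, b k ^ q := by
  have hb : ∀ k, b k ≤ (∑' j, b j ^ q) ^ q⁻¹ := fun k => by
    rw [ENNReal.le_rpow_inv_iff hq]
    exact ENNReal.le_tsum (f := fun j => b j ^ q) k
  calc (∑' k, u k * b k) ^ q ≤ ((∑' k, u k) * (∑' j, b j ^ q) ^ q⁻¹) ^ q := by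
        rw [← ENNReal.tsum_mul_right]
        gcongr with k
        exact hb k
    _ = (∑' k, u k) ^ q * ∑' k, b k ^ q := by
        rw [ENNReal.mul_rpow_of_nonneg _ _ hq.le, ENNReal.rpow_inv_rpow hq.ne']

theorem summable_two_rpow_neg_mul_abs {e : ℝ} (he : 0 < e) :
    Summable fun k : ℤ => (2 : ℝ) ^ (-(e * |(k : ℝ)|)) := by
  have h : Summable fun n : ℕ => (2 : ℝ) ^ (-(e * n)) := by
    have := summable_geometric_of_lt_one (r := (2 : ℝ) ^ (-e)) (by positivity)
      (Real.rpow_lt_one_of_one_lt_of_neg one_lt_two (by linarith))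
    refine this.congr fun n => ?_
    rw [← Real.rpow_natCast, ← Real.rpow_mul zero_le_two, neg_mul]
  refine Summable.of_nat_of_neg ?_ ?_ <;> simpa using h

theorem setLIntegral_le_rpow_mul_measure_rpow {μ : Measure X} {p : ℝ} (hp : 1 < p)
    {f : X → ℝ≥0∞} (hf : Measurable f) (A : Set X) :
    ∫⁻ y in A, f y ∂μ ≤ (∫⁻ y in A, f y ^ p ∂μ) ^ (1 / p) * μ A ^ (1 - 1 / p) := by
  have h := ENNReal.lintegral_mul_le_Lp_mul_Lq (μ.restrict A)
    (Real.HolderConjugate.conjExponent hp) hf.aemeasurable (measurable_const (a := 1)).aemeasurable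
  have hp' : 1 / p.conjExponent = 1 - 1 / p := by
    rw [Real.conjExponent]
    field_simp
  simpa [hp'] using h

/-- Dyadic decomposition of the fractional integral. -/
theorem Iop_le_tsum {ρ : X → X → ℝ} {μ : Measure X} (hρ : ∀ x y, 0 ≤ ρ x y)
    (hmeas : ∀ a r, MeasurableSet (qball ρ a r)) {α r : ℝ} (hα : α < 1) (hr : 0 < r)
    {f : X → ℝ≥0∞} (hf : Measurable f) (x : X) :
    Iop ρ μ α f x ≤ ∑' k : ℤ, ENNReal.ofReal ((2 ^ ((k : ℝ) - 1) * r) ^ (α - 1)) *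
      ∫⁻ y in qball ρ x (2 ^ (k : ℝ) * r), f y ∂μ := by
  have : ∀ k : ℤ, ENNReal.ofReal ((2 ^ ((k : ℝ) - 1) * r) ^ (α - 1)) *
      ∫⁻ y in qball ρ x (2 ^ (k : ℝ) * r), f y ∂μ =
      ∫⁻ y, (qball ρ x (2 ^ (k : ℝ) * r)).indicator
        (fun y => ENNReal.ofReal ((2 ^ ((k : ℝ) - 1) * r) ^ (α - 1)) * f y) y ∂μ := fun k => by
    rw [lintegral_indicator (hmeas _ _), lintegral_const_mul _ hf]
  simp_rw [this]
  rw [← lintegral_tsum fun k => ((hf.const_mul _).indicator (hmeas _ _)).aemeasurable]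
  refine lintegral_mono fun y => ?_
  rcases (hρ x y).eq_or_lt with h0 | h0
  · simp [← h0, Real.zero_rpow (by linarith : α - 1 ≠ 0)]
  · obtain ⟨n, hn1, hn2⟩ := exists_mem_Ico_zpow (div_pos h0 hr) one_lt_two
    refine le_trans ?_ (ENNReal.le_tsum (n + 1))
    rw [indicator_of_mem, mul_comm]
    · gcongr ENNReal.ofReal ?_ * _
      refine Real.rpow_le_rpow_of_nonpos (by positivity) ?_ (by linarith)
      rw [le_div_iff₀ hr, ← Real.rpow_intCast] at hn1
      simpa using hn1
    · rw [div_lt_iff₀ hr, ← Real.rpow_intCast] at hn2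
      exact hn2

theorem lintegral_qball_rpow_le {ρ : X → X → ℝ} {μ : Measure X} {p : ℝ} (hp : 0 < p) (lam : ℝ)
    (f : X → ℝ≥0∞) (a : X) {r : ℝ} (hr : 0 < r) :
    ∫⁻ y in qball ρ a r, f y ^ p ∂μ ≤
      ENNReal.ofReal (r ^ lam) * wMorreyNorm ρ μ p lam 0 f ^ p := by
  have h : (ENNReal.ofReal r ^ (-lam) * ∫⁻ y in qball ρ a r, f y ^ p ∂μ) ^ (1 / p) ≤
      wMorreyNorm ρ μ p lam 0 f := by
    rw [wMorreyNorm]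
    refine le_iSup_of_le a (le_iSup_of_le r (le_iSup_of_le hr ?_))
    simp
  rw [one_div, ENNReal.rpow_inv_le_iff hp, ENNReal.ofReal_rpow_of_pos hr] at h
  calc ∫⁻ y in qball ρ a r, f y ^ p ∂μ
      = ENNReal.ofReal (r ^ lam) *
          (ENNReal.ofReal (r ^ (-lam)) * ∫⁻ y in qball ρ a r, f y ^ p ∂μ) := by
        rw [← mul_assoc, ← ENNReal.ofReal_mul (by positivity), ← Real.rpow_add hr]
        simp
    _ ≤ _ := by gcongr

/-- Gain of integrability for averages over `t`-balls of a function of Morrey type, with decay as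
`t / r` tends to `0` or to `∞`. -/
theorem IsQuasimetric.exists_majorant_rpow {ρ : X → X → ℝ} {μ : Measure X} {a₀ a₁ : ℝ}
    (hρ : IsQuasimetric ρ a₀ a₁) (hmeas : ∀ a r, MeasurableSet (qball ρ a r))
    (hfin : ∀ a r, μ (qball ρ a r) < ⊤) {C s l κ e : ℝ} (hC : 0 < C)
    (hgrow : ∀ a r, 0 < r → μ (qball ρ a r) ≤ ENNReal.ofReal (C * r ^ s))
    (hκ : 1 ≤ κ) (he : e ≤ l * (κ - 1)) (he' : e ≤ s - l * κ) :
    ∃ D : ℝ, 0 < D ∧ ∀ (g : X → ℝ≥0∞) (P : ℝ≥0∞), Measurable g →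
      (∀ a r, 0 < r → ∫⁻ y in qball ρ a r, g y ∂μ ≤ ENNReal.ofReal (r ^ l) * P) →
      ∀ r k : ℝ, 0 < r → ∃ G : X → ℝ≥0∞, Measurable G ∧
        (∀ x, ∫⁻ y in qball ρ x (2 ^ k * r), g y ∂μ ≤ G x) ∧
        ∀ a, ∫⁻ x in qball ρ a r, G x ^ κ ∂μ ≤
          ENNReal.ofReal (D * r ^ (l * κ) * (2 ^ k * r) ^ s * 2 ^ (-(e * |k|))) * P ^ κ := by
  obtain ⟨K, hK, hmaj⟩ := hρ.exists_measurable_majorant hmeas hfin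
  have hK0 : 0 < K := by linarith
  refine ⟨C * (K ^ (l * κ) * max 1 (K ^ s)), by positivity, fun g P hg hP r k hr => ?_⟩
  obtain ⟨t, ht⟩ : ∃ t, t = 2 ^ k * r := ⟨_, rfl⟩
  have ht0 : 0 < t := by rw [ht]; positivity
  rw [← ht]
  obtain ⟨G, hGm, hGlow, hGup, hGint⟩ := hmaj t ht0 g hg
  have hGP : ∀ x, G x ≤ ENNReal.ofReal ((K * t) ^ l) * P := fun x =>
    (hGup x).trans (hP x _ (by positivity))
  refine ⟨G, hGm, hGlow, fun a => ?_⟩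
  rcases le_total k 0 with hk | hk
  · have htr : t ≤ r := by
      rw [ht]
      exact mul_le_of_le_one_left hr.le (Real.rpow_le_one_of_one_le_of_nonpos one_le_two hk)
    calc ∫⁻ x in qball ρ a r, G x ^ κ ∂μ
        ≤ ∫⁻ x in qball ρ a r, (ENNReal.ofReal ((K * t) ^ l) * P) ^ (κ - 1) * G x ∂μ := by
          refine lintegral_mono fun x => ?_
          calc G x ^ κ = G x ^ (κ - 1) * G x ^ (1 : ℝ) := by
                rw [← ENNReal.rpow_add_of_nonneg _ _ (by linarith) zero_le_one, sub_add_cancel]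
            _ ≤ _ := by
                rw [ENNReal.rpow_one]
                have hκ' : 0 ≤ κ - 1 := by linarith
                gcongr
                exact hGP x
      _ = (ENNReal.ofReal ((K * t) ^ l) * P) ^ (κ - 1) * ∫⁻ x in qball ρ a r, G x ∂μ :=
          lintegral_const_mul _ hGm
      _ ≤ (ENNReal.ofReal ((K * t) ^ l) * P) ^ (κ - 1) *
            (ENNReal.ofReal (C * (K * t) ^ s) * (ENNReal.ofReal ((K * r) ^ l) * P)) := by
          gcongr
          refine (hGint _ (fun y => hgrow y _ (by positivity)) a r htr).trans ?_
          gcongr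
          exact hP a _ (by positivity)
      _ = ENNReal.ofReal (((K * t) ^ l) ^ (κ - 1) * ((C * (K * t) ^ s) * (K * r) ^ l)) *
            P ^ κ := by
          rw [ENNReal.mul_rpow_of_nonneg _ _ (by linarith),
            ENNReal.ofReal_rpow_of_pos (by positivity),
            ENNReal.ofReal_mul (p := _ ^ (κ - 1)) (by positivity),
            ENNReal.ofReal_mul (p := C * _) (by positivity)]
          have : P ^ κ = P ^ (κ - 1) * P := by
            nth_rw 3 [← ENNReal.rpow_one P]
            rw [← ENNReal.rpow_add_of_nonneg _ _ (by linarith) zero_le_one, sub_add_cancel]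
          rw [this]
          ring
      _ ≤ _ := by
          gcongr ENNReal.ofReal ?_ * _
          have h1 : (2 : ℝ) ^ (k * (l * (κ - 1))) ≤ 2 ^ (-(e * |k|)) := by
            refine Real.rpow_le_rpow_of_exponent_le one_le_two ?_
            rw [abs_of_nonpos hk]
            nlinarith
          have h2 : ((K * t) ^ l) ^ (κ - 1) * ((C * (K * t) ^ s) * (K * r) ^ l) =
              C * (K ^ (l * κ) * K ^ s) * r ^ (l * κ) * t ^ s * 2 ^ (k * (l * (κ - 1))) := by
            have e1 : l * κ = l * (κ - 1) + l := by ring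
            rw [← Real.rpow_mul (by positivity), Real.mul_rpow hK0.le ht0.le,
              Real.mul_rpow hK0.le ht0.le, Real.mul_rpow hK0.le hr.le]
            nth_rw 1 [ht]
            rw [Real.mul_rpow (by positivity) hr.le, ← Real.rpow_mul zero_le_two, e1,
              Real.rpow_add hK0, Real.rpow_add hr]
            ring
          rw [h2]
          gcongr
          exact le_max_right _ _
  · calc ∫⁻ x in qball ρ a r, G x ^ κ ∂μ
        ≤ ∫⁻ _ in qball ρ a r, (ENNReal.ofReal ((K * t) ^ l) * P) ^ κ ∂μ :=
          lintegral_mono fun x => by gcongr; exact hGP x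
      _ ≤ (ENNReal.ofReal ((K * t) ^ l) * P) ^ κ * ENNReal.ofReal (C * r ^ s) := by
          rw [setLIntegral_const]
          gcongr
          exact hgrow a r hr
      _ = ENNReal.ofReal (((K * t) ^ l) ^ κ * (C * r ^ s)) * P ^ κ := by
          rw [ENNReal.mul_rpow_of_nonneg _ _ (by linarith),
            ENNReal.ofReal_rpow_of_pos (by positivity),
            ENNReal.ofReal_mul (p := _ ^ κ) (by positivity)]
          ring
      _ ≤ _ := by
          gcongr ENNReal.ofReal ?_ * _
          have h1 : (2 : ℝ) ^ (-(k * (s - l * κ))) ≤ 2 ^ (-(e * |k|)) := by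
            refine Real.rpow_le_rpow_of_exponent_le one_le_two ?_
            rw [abs_of_nonneg hk]
            nlinarith
          have h2 : ((K * t) ^ l) ^ κ * (C * r ^ s) =
              C * (K ^ (l * κ) * 1) * r ^ (l * κ) * t ^ s * 2 ^ (-(k * (s - l * κ))) := by
            have e1 : (2 : ℝ) ^ (k * (l * κ)) = 2 ^ (k * s) * 2 ^ (-(k * (s - l * κ))) := by
              rw [← Real.rpow_add zero_lt_two]
              ring_nf
            rw [← Real.rpow_mul (by positivity), Real.mul_rpow hK0.le ht0.le, ht,
              Real.mul_rpow (by positivity) hr.le, ← Real.rpow_mul zero_le_two, e1,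
              Real.mul_rpow (by positivity) hr.le, ← Real.rpow_mul zero_le_two]
            ring
          rw [h2]
          gcongr
          exact le_max_left _ _

/-- Single dyadic piece of the fractional integral, in terms of a majorant of a ball average
of `f ^ p`. -/
theorem dyadic_piece_le {ρ : X → X → ℝ} {μ : Measure X} {p q α s C r k : ℝ} {x : X} (hp : 1 < p)
    (hexp : 1 - α = s * (1 / q + (1 - 1 / p))) (hC : 0 < C) (hr : 0 < r)
    (hgrow : ∀ a r, 0 < r → μ (qball ρ a r) ≤ ENNReal.ofReal (C * r ^ s))
    {f : X → ℝ≥0∞} (hf : Measurable f) {G : ℝ≥0∞}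
    (hG : ∫⁻ y in qball ρ x (2 ^ k * r), f y ^ p ∂μ ≤ G) :
    ENNReal.ofReal ((2 ^ (k - 1) * r) ^ (α - 1)) * ∫⁻ y in qball ρ x (2 ^ k * r), f y ∂μ ≤
      ENNReal.ofReal (2 ^ (1 - α) * C ^ (1 - 1 / p)) *
        (ENNReal.ofReal ((2 ^ k * r) ^ (-(s / q))) * G ^ (1 / p)) := by
  obtain ⟨t, ht⟩ : ∃ t, t = 2 ^ k * r := ⟨_, rfl⟩
  have ht0 : 0 < t := by rw [ht]; positivity
  have hp' : 0 ≤ 1 - 1 / p := by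
    rw [sub_nonneg, div_le_one (by linarith)]
    exact hp.le
  have ht2 : 2 ^ (k - 1) * r = 2⁻¹ * t := by
    rw [ht, Real.rpow_sub_one two_ne_zero]
    ring
  have hreal : (2⁻¹ * t) ^ (α - 1) * (C * t ^ s) ^ (1 - 1 / p) =
      2 ^ (1 - α) * C ^ (1 - 1 / p) * t ^ (-(s / q)) := by
    rw [Real.mul_rpow (by positivity) ht0.le, Real.mul_rpow hC.le (by positivity),
      Real.inv_rpow zero_le_two, ← Real.rpow_neg zero_le_two, neg_sub, ← Real.rpow_mul ht0.le]
    have : t ^ (-(s / q)) = t ^ (α - 1) * t ^ (s * (1 - 1 / p)) := by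
      rw [← Real.rpow_add ht0]
      congr 1
      have : α - 1 = -(s * (1 / q + (1 - 1 / p))) := by linarith
      rw [this]
      ring
    rw [this]
    ring
  rw [ht2, ← ht]
  rw [← ht] at hG
  calc ENNReal.ofReal ((2⁻¹ * t) ^ (α - 1)) * ∫⁻ y in qball ρ x t, f y ∂μ
      ≤ ENNReal.ofReal ((2⁻¹ * t) ^ (α - 1)) *
          (G ^ (1 / p) * ENNReal.ofReal (C * t ^ s) ^ (1 - 1 / p)) := by
        gcongr
        refine (setLIntegral_le_rpow_mul_measure_rpow hp hf _).trans ?_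
        gcongr
        exact hgrow x t ht0
    _ = ENNReal.ofReal ((2⁻¹ * t) ^ (α - 1) * (C * t ^ s) ^ (1 - 1 / p)) * G ^ (1 / p) := by
        rw [ENNReal.ofReal_rpow_of_pos (by positivity), ENNReal.ofReal_mul (by positivity)]
        ring
    _ = _ := by
        rw [hreal, ENNReal.ofReal_mul (by positivity), mul_assoc]

/-- Local `L^q` estimate for the fractional integral of a Morrey function. -/
theorem IsQuasimetric.lintegral_Iop_rpow_le {ρ : X → X → ℝ} {μ : Measure X} {a₀ a₁ : ℝ}
    (hρ : IsQuasimetric ρ a₀ a₁) (hmeas : ∀ a r, MeasurableSet (qball ρ a r))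
    (hfin : ∀ a r, μ (qball ρ a r) < ⊤) {p q α s C l : ℝ} (hp : 1 < p) (hpq : p < q) (hα : α < 1)
    (hexp : 1 - α = s * (1 / q + (1 - 1 / p))) (hC : 0 < C)
    (hgrow : ∀ a r, 0 < r → μ (qball ρ a r) ≤ ENNReal.ofReal (C * r ^ s))
    (hl : 0 < l) (hls : l * (q / p) < s) :
    ∃ E : ℝ≥0∞, E ≠ ⊤ ∧ ∀ f : X → ℝ≥0∞, Measurable f → ∀ a r, 0 < r →
      ∫⁻ x in qball ρ a r, Iop ρ μ α f x ^ q ∂μ ≤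
        E * ENNReal.ofReal (r ^ (l * (q / p))) * wMorreyNorm ρ μ p l 0 f ^ q := by
  have hp0 : 0 < p := by linarith
  have hq0 : 0 < q := by linarith
  have hκ : 1 < q / p := (one_lt_div hp0).2 hpq
  obtain ⟨e, he0, he1, he2⟩ : ∃ e, 0 < e ∧ e ≤ l * (q / p - 1) ∧ e ≤ s - l * (q / p) :=
    ⟨min _ _, lt_min (mul_pos hl (by linarith)) (by linarith), min_le_left _ _, min_le_right _ _⟩
  obtain ⟨D, hD, hmaj⟩ := hρ.exists_majorant_rpow hmeas hfin hC hgrow hκ.le he1 he2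
  obtain ⟨δ, hδ⟩ : ∃ δ, δ = e / (2 * q) := ⟨_, rfl⟩
  have hδ0 : 0 < δ := by rw [hδ]; positivity
  obtain ⟨A, hA⟩ : ∃ A : ℝ, A = 2 ^ (1 - α) * C ^ (1 - 1 / p) := ⟨_, rfl⟩
  obtain ⟨U, hU⟩ : ∃ U, U = ∑' k : ℤ, ENNReal.ofReal (2 ^ (-(δ * |(k : ℝ)|))) := ⟨_, rfl⟩
  obtain ⟨V, hV⟩ : ∃ V, V = ∑' k : ℤ, ENNReal.ofReal (2 ^ (-(e / 2 * |(k : ℝ)|))) := ⟨_, rfl⟩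
  have hUtop : U ≠ ⊤ := hU ▸ (summable_two_rpow_neg_mul_abs hδ0).tsum_ofReal_ne_top
  have hVtop : V ≠ ⊤ := hV ▸ (summable_two_rpow_neg_mul_abs (half_pos he0)).tsum_ofReal_ne_top
  refine ⟨(ENNReal.ofReal A * U) ^ q * (ENNReal.ofReal D * V),
    ENNReal.mul_ne_top (ENNReal.rpow_ne_top_of_nonneg hq0.le
      (ENNReal.mul_ne_top ENNReal.ofReal_ne_top hUtop))
      (ENNReal.mul_ne_top ENNReal.ofReal_ne_top hVtop), fun f hf a r hr => ?_⟩
  obtain ⟨N, hN⟩ : ∃ N, N = wMorreyNorm ρ μ p l 0 f := ⟨_, rfl⟩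
  rw [← hN]
  choose G hGm hGlow hGint using fun k : ℤ => hmaj (fun y => f y ^ p) (N ^ p) (hf.pow_const p)
    (fun a r hr => hN ▸ lintegral_qball_rpow_le hp0 l f a hr) r k hr
  obtain ⟨w, hw⟩ : ∃ w : ℤ → ℝ, w = fun k : ℤ =>
    2 ^ (δ * |(k : ℝ)|) * ((2 : ℝ) ^ (k : ℝ) * r) ^ (-(s / q)) := ⟨_, rfl⟩
  have hw0 : ∀ k, 0 < w k := fun k => by rw [hw]; positivity
  have hpt : ∀ x, Iop ρ μ α f x ^ q ≤
      (ENNReal.ofReal A * U) ^ q * ∑' k, ENNReal.ofReal (w k ^ q) * G k x ^ (q / p) := fun x => by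
    calc Iop ρ μ α f x ^ q
        ≤ (∑' k : ℤ, ENNReal.ofReal A * (ENNReal.ofReal (2 ^ (-(δ * |(k : ℝ)|))) *
            (ENNReal.ofReal (w k) * G k x ^ (1 / p)))) ^ q := by
          gcongr
          refine (Iop_le_tsum hρ.nonneg hmeas hα hr hf x).trans (ENNReal.tsum_le_tsum fun k => ?_)
          refine (dyadic_piece_le hp hexp hC hr hgrow hf (hGlow k x)).trans_eq ?_
          rw [← hA, ← mul_assoc (ENNReal.ofReal (2 ^ (-(δ * |(k : ℝ)|)))),
            ← ENNReal.ofReal_mul (by positivity), hw, ← mul_assoc (2 ^ (-(δ * |(k : ℝ)|))),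
            ← Real.rpow_add zero_lt_two, neg_add_cancel, Real.rpow_zero, one_mul]
      _ ≤ ENNReal.ofReal A ^ q *
            (U ^ q * ∑' k, (ENNReal.ofReal (w k) * G k x ^ (1 / p)) ^ q) := by
          rw [ENNReal.tsum_mul_left, ENNReal.mul_rpow_of_nonneg _ _ hq0.le, hU]
          gcongr
          exact ENNReal.tsum_mul_rpow_le _ _ hq0
      _ = _ := by
          rw [ENNReal.mul_rpow_of_nonneg _ _ hq0.le, mul_assoc]
          congr! 4 with k
          rw [ENNReal.mul_rpow_of_nonneg _ _ hq0.le, ENNReal.ofReal_rpow_of_pos (hw0 k),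
            ← ENNReal.rpow_mul, one_div_mul_eq_div]
  calc ∫⁻ x in qball ρ a r, Iop ρ μ α f x ^ q ∂μ
      ≤ ∫⁻ x in qball ρ a r, (ENNReal.ofReal A * U) ^ q *
          ∑' k, ENNReal.ofReal (w k ^ q) * G k x ^ (q / p) ∂μ := lintegral_mono hpt
    _ = (ENNReal.ofReal A * U) ^ q *
          ∑' k, ENNReal.ofReal (w k ^ q) * ∫⁻ x in qball ρ a r, G k x ^ (q / p) ∂μ := by
        rw [lintegral_const_mul _
            (Measurable.tsum fun k => ((hGm k).pow_const _).const_mul _),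
          lintegral_tsum fun k => (((hGm k).pow_const _).const_mul _).aemeasurable]
        congr! 3 with k
        rw [lintegral_const_mul _ ((hGm k).pow_const _)]
    _ ≤ (ENNReal.ofReal A * U) ^ q * ∑' k : ℤ, ENNReal.ofReal (D * r ^ (l * (q / p))) * N ^ q *
          ENNReal.ofReal (2 ^ (-(e / 2 * |(k : ℝ)|))) := by
        refine mul_le_mul_right (ENNReal.tsum_le_tsum fun k => ?_) _
        calc ENNReal.ofReal (w k ^ q) * ∫⁻ x in qball ρ a r, G k x ^ (q / p) ∂μ
            ≤ ENNReal.ofReal (w k ^ q) * (ENNReal.ofReal (D * r ^ (l * (q / p)) *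
                (2 ^ (k : ℝ) * r) ^ s * 2 ^ (-(e * |(k : ℝ)|))) * (N ^ p) ^ (q / p)) := by
              gcongr
              exact hGint k a
          _ = ENNReal.ofReal (w k ^ q * (D * r ^ (l * (q / p)) *
                (2 ^ (k : ℝ) * r) ^ s * 2 ^ (-(e * |(k : ℝ)|)))) * N ^ q := by
              rw [← ENNReal.rpow_mul, mul_div_cancel₀ _ hp0.ne', ← mul_assoc,
                ← ENNReal.ofReal_mul (Real.rpow_nonneg (hw0 k).le _)]
          _ = ENNReal.ofReal (D * r ^ (l * (q / p)) * 2 ^ (-(e / 2 * |(k : ℝ)|))) * N ^ q := by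
              congr 2
              have ht0 : 0 < (2 : ℝ) ^ (k : ℝ) * r := by positivity
              have h1 : w k ^ q = 2 ^ (e / 2 * |(k : ℝ)|) * (2 ^ (k : ℝ) * r) ^ (-s) := by
                rw [hw, Real.mul_rpow (by positivity) (by positivity), ← Real.rpow_mul zero_le_two,
                  ← Real.rpow_mul ht0.le, hδ]
                congr 2 <;> field_simp
              have h2 : (2 : ℝ) ^ (-(e / 2 * |(k : ℝ)|)) =
                  2 ^ (e / 2 * |(k : ℝ)|) * 2 ^ (-(e * |(k : ℝ)|)) := by
                rw [← Real.rpow_add zero_lt_two]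
                ring_nf
              have h3 : ((2 : ℝ) ^ (k : ℝ) * r) ^ (-s) * (2 ^ (k : ℝ) * r) ^ s = 1 := by
                rw [← Real.rpow_add ht0, neg_add_cancel, Real.rpow_zero]
              rw [h1, h2]
              linear_combination (D * r ^ (l * (q / p)) * 2 ^ (e / 2 * |(k : ℝ)|) *
                2 ^ (-(e * |(k : ℝ)|))) * h3
          _ = _ := by
              rw [ENNReal.ofReal_mul (by positivity)]
              ring
    _ = _ := by
        rw [ENNReal.tsum_mul_left, ← hV, ENNReal.ofReal_mul hD.le]
        ring

/-- Theorem 3.4: boundedness of `I_α` between (unweighted) Morrey spaces `M^{p,λ₁s} → M^{q,λ₂}`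
under the measure growth condition `μ(B(a,r)) ≤ C r^s`, `s = pq(1-α)/(pq+p-q)`. -/
theorem Iop_morrey_bounded_of_growth
    (ρ : X → X → ℝ) (μ : Measure X) (a₀ a₁ : ℝ)
    (ha₀ : 1 ≤ a₀) (ha₁ : 1 ≤ a₁)
    (hρ_nonneg : ∀ x y, 0 ≤ ρ x y)
    (hρ_pos : ∀ x y, x ≠ y → 0 < ρ x y)
    (hρ_self : ∀ x, ρ x x = 0)
    (hρ_sym : ∀ x y, ρ x y ≤ a₀ * ρ y x)
    (hρ_tri : ∀ x y z, ρ x y ≤ a₁ * (ρ x z + ρ z y))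
    (hball_meas : ∀ a r, MeasurableSet (qball ρ a r))
    (hball_fin : ∀ a r, μ (qball ρ a r) < ⊤)
    (hXinf : μ Set.univ = ⊤) (hatoms : ∀ x : X, μ {x} = 0)
    (p q α s lam₁ lam₂ : ℝ)
    (hp : 1 < p) (hpq : p < q) (hα₀ : 0 < α) (hα₁ : α < 1)
    (hs : s = p * q * (1 - α) / (p * q + p - q))
    (C : ℝ) (hC : 0 < C)
    (hgrow : ∀ a : X, ∀ r : ℝ, 0 < r → μ (qball ρ a r) ≤ ENNReal.ofReal (C * r ^ s))
    (hlam₁0 : 0 < lam₁) (hlam₁ : lam₁ < p / q)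
    (hlam : s * lam₁ / p = lam₂ / q) :
    ∃ C' : ℝ≥0∞, 0 < C' ∧ C' ≠ ⊤ ∧ ∀ f : X → ℝ≥0∞, Measurable f →
      wMorreyNorm ρ μ q lam₂ 0 (Iop ρ μ α f) ≤ C' * wMorreyNorm ρ μ p (lam₁ * s) 0 f := by
  have hp0 : 0 < p := by linarith
  have hq0 : 0 < q := by linarith
  have hden : 0 < p * q + p - q := by nlinarith
  have hs0 : 0 < s := by
    rw [hs]
    have : 0 < 1 - α := by linarith
    positivity
  have hexp : 1 - α = s * (1 / q + (1 - 1 / p)) := by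
    have : 1 / q + (1 - 1 / p) = (p * q + p - q) / (p * q) := by
      field_simp
      ring
    rw [hs, this]
    have hpq0 : p * q ≠ 0 := by positivity
    rw [div_mul_div_comm, eq_div_iff (mul_ne_zero hden.ne' hpq0)]
    ring
  have hlam₂ : lam₂ = lam₁ * s * (q / p) := by
    field_simp at hlam ⊢
    linarith
  have hls : lam₁ * s * (q / p) < s := by
    rw [lt_div_iff₀ hq0] at hlam₁
    have : lam₁ * q / p < 1 := (div_lt_one hp0).2 hlam₁
    calc lam₁ * s * (q / p) = s * (lam₁ * q / p) := by ring
      _ < s := mul_lt_of_lt_one_right hs0 this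
  obtain ⟨E, hE, h⟩ := IsQuasimetric.lintegral_Iop_rpow_le
    ⟨ha₀, ha₁, hρ_nonneg, hρ_self, hρ_sym, hρ_tri⟩ hball_meas hball_fin hp hpq hα₁ hexp hC hgrow
    (mul_pos hlam₁0 hs0) hls
  refine ⟨E ^ (1 / q) + 1, by positivity,
    ENNReal.add_ne_top.2 ⟨ENNReal.rpow_ne_top_of_nonneg (by positivity) hE, one_ne_top⟩,
    fun f hf => ?_⟩
  obtain ⟨N, hN⟩ : ∃ N, N = wMorreyNorm ρ μ p (lam₁ * s) 0 f := ⟨_, rfl⟩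
  rw [← hN, wMorreyNorm]
  refine iSup_le fun a => iSup_le fun r => iSup_le fun hr => ?_
  simp only [Real.rpow_zero, ENNReal.ofReal_one, mul_one]
  calc (ENNReal.ofReal r ^ (-lam₂) * ∫⁻ x in qball ρ a r, Iop ρ μ α f x ^ q ∂μ) ^ (1 / q)
      ≤ (ENNReal.ofReal (r ^ (-lam₂)) * (E * ENNReal.ofReal (r ^ lam₂) * N ^ q)) ^ (1 / q) := by
        rw [ENNReal.ofReal_rpow_of_pos hr]
        gcongr
        rw [hN, hlam₂]
        exact h f hf a r hr
    _ = (E * N ^ q) ^ (1 / q) := by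
        have : ENNReal.ofReal (r ^ (-lam₂)) * ENNReal.ofReal (r ^ lam₂) = 1 := by
          rw [← ENNReal.ofReal_mul (by positivity), ← Real.rpow_add hr]
          simp
        rw [mul_comm E, mul_assoc, ← mul_assoc, this, one_mul]
    _ = E ^ (1 / q) * N := by
        rw [ENNReal.mul_rpow_of_nonneg _ _ (by positivity), one_div, ENNReal.rpow_rpow_inv hq0.ne']
    _ ≤ (E ^ (1 / q) + 1) * N := by
        gcongr
        exact le_self_add
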